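/- Let G be a connected simple graph on n ≥ 2 vertices. Then ρ(D^Q(G)) ≥ 2n − 2, with equality if and only if G is the complete graph K_n. -/

import Mathlib

open Matrix BigOperators

/-- The distance matrix of a graph: the `(u,v)` entry is the graph distance from `u` to `v`. -/
noncomputable def distMatrix {V : Type*} [Fintype V] (G : SimpleGraph V) : Matrix V V ℝ :=
  Matrix.of fun u v => (G.dist u v : ℝ)

/-- The transmission of a vertex: the sum of the distances to all vertices. -/
noncomputable def transmission {V : Type*} [Fintype V] (G : SimpleGraph V) (v : V) : ℝ :=
  ∑ u, (G.dist v u : ℝ)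

/-- The distance signless Laplacian `D^Q(G) = T(G) + D(G)`. -/
noncomputable def distSignlessLap {V : Type*} [Fintype V] [DecidableEq V] (G : SimpleGraph V) :
    Matrix V V ℝ :=
  Matrix.diagonal (transmission G) + distMatrix G

/-- The distance Laplacian `D^L(G) = T(G) - D(G)`. -/
noncomputable def distLap {V : Type*} [Fintype V] [DecidableEq V] (G : SimpleGraph V) :
    Matrix V V ℝ :=
  Matrix.diagonal (transmission G) - distMatrix G

/-- The normalized distance Laplacian `D^NL(G) = T(G)^{-1/2} D^L(G) T(G)^{-1/2}`. -/
noncomputable def normDistLap {V : Type*} [Fintype V] [DecidableEq V] (G : SimpleGraph V) :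
    Matrix V V ℝ :=
  Matrix.diagonal (fun v => (Real.sqrt (transmission G v))⁻¹) * distLap G *
    Matrix.diagonal (fun v => (Real.sqrt (transmission G v))⁻¹)

/-- The spectral radius of a real matrix: the supremum of absolute values of its
(real) eigenvalues. -/
noncomputable def specRad {V : Type*} [Fintype V] [DecidableEq V] (M : Matrix V V ℝ) : ℝ :=
  sSup (abs '' spectrum ℝ M)

/-- The vector `e_u - e_v`. -/
noncomputable def signVec {V : Type*} [DecidableEq V] (u v : V) : V → ℝ :=
  Pi.single u 1 - Pi.single v 1

theorem le_specRad {V : Type*} [Fintype V] [DecidableEq V] (M : Matrix V V ℝ) {μ : ℝ}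
    (hμ : μ ∈ spectrum ℝ M) : |μ| ≤ specRad M :=
  le_csSup (M.finite_real_spectrum.image abs).bddAbove ⟨μ, hμ, rfl⟩

theorem Matrix.IsHermitian.dotProduct_mulVec_le_specRad {V : Type*} [Fintype V] [DecidableEq V]
    {M : Matrix V V ℝ} (hM : M.IsHermitian) (x : V → ℝ) :
    x ⬝ᵥ (M *ᵥ x) ≤ specRad M * (x ⬝ᵥ x) := by
  have hpsd : (algebraMap ℝ (Matrix V V ℝ) (specRad M) - M).PosSemidef := by
    refine posSemidef_iff_isHermitian_and_spectrum_nonneg.mpr ⟨?_, ?_⟩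
    · refine IsHermitian.sub ?_ hM
      rw [Matrix.algebraMap_eq_diagonal]
      exact isHermitian_diagonal _
    · rw [← spectrum.singleton_sub_eq]
      rintro _ ⟨r, rfl, μ, hμ, rfl⟩
      exact sub_nonneg.mpr ((le_abs_self μ).trans (le_specRad M hμ))
  have h := hpsd.dotProduct_mulVec_nonneg x
  rw [Algebra.algebraMap_eq_smul_one, sub_mulVec, smul_mulVec, one_mulVec, star_trivial,
    dotProduct_sub, dotProduct_smul, smul_eq_mul] at h
  linarith

theorem specRad_le_of_forall_row {V : Type*} [Fintype V] [DecidableEq V] (M : Matrix V V ℝ)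
    {c : ℝ} (hc : 0 ≤ c) (h : ∀ i, ∑ j, |M i j| ≤ c) : specRad M ≤ c := by
  refine Real.sSup_le ?_ hc
  rintro _ ⟨μ, hμ, rfl⟩
  rw [← Matrix.spectrum_toLin', ← Module.End.hasEigenvalue_iff_mem_spectrum] at hμ
  obtain ⟨k, hk⟩ := eigenvalue_mem_ball hμ
  rw [Metric.mem_closedBall, Real.dist_eq] at hk
  have hsum := Finset.add_sum_erase Finset.univ (fun j => |M k j|) (Finset.mem_univ k)
  simp only [Real.norm_eq_abs] at hk hsum
  have := abs_sub_abs_le_abs_sub μ (M k k)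
  linarith [h k]

theorem isHermitian_distSignlessLap {V : Type*} [Fintype V] [DecidableEq V]
    (G : SimpleGraph V) : (distSignlessLap G).IsHermitian := by
  refine (isHermitian_diagonal _).add ?_
  ext u v
  simp [distMatrix, G.dist_comm]

theorem distSignlessLap_nonneg {V : Type*} [Fintype V] [DecidableEq V]
    (G : SimpleGraph V) (u v : V) : 0 ≤ distSignlessLap G u v := by
  have ht : 0 ≤ transmission G u := Finset.sum_nonneg fun _ _ => Nat.cast_nonneg _
  simp only [distSignlessLap, distMatrix, Matrix.add_apply, Matrix.diagonal_apply, Matrix.of_apply]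
  split_ifs <;> positivity

theorem sum_distSignlessLap {V : Type*} [Fintype V] [DecidableEq V]
    (G : SimpleGraph V) (u : V) : ∑ v, distSignlessLap G u v = 2 * transmission G u := by
  simp only [distSignlessLap, distMatrix, Matrix.add_apply, Matrix.diagonal_apply,
    Matrix.of_apply, Finset.sum_add_distrib, Finset.sum_ite_eq, Finset.mem_univ, if_true]
  rw [transmission, two_mul]

theorem transmission_top {V : Type*} [Fintype V] (v : V) :
    transmission (⊤ : SimpleGraph V) v = Fintype.card V - 1 := by
  classical
  simp [transmission, SimpleGraph.dist_top, Finset.sum_ite, Finset.filter_ne,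
    Finset.card_erase_of_mem, Nat.cast_pred (Fintype.card_pos_iff.mpr ⟨v⟩)]

theorem SimpleGraph.Connected.dist_top_le {V : Type*} {G : SimpleGraph V} (hG : G.Connected)
    (u v : V) : (⊤ : SimpleGraph V).dist u v ≤ G.dist u v :=
  (hG u v).dist_anti le_top

theorem SimpleGraph.Connected.transmission_ge {V : Type*} [Fintype V] {G : SimpleGraph V}
    (hG : G.Connected) (v : V) : (Fintype.card V : ℝ) - 1 ≤ transmission G v := by
  rw [← transmission_top v]
  exact Finset.sum_le_sum fun u _ => by exact_mod_cast hG.dist_top_le v u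

theorem SimpleGraph.Connected.eq_top_of_transmission_le {V : Type*} [Fintype V]
    {G : SimpleGraph V} (hG : G.Connected)
    (h : ∀ v, transmission G v ≤ Fintype.card V - 1) : G = ⊤ := by
  refine eq_top_iff.mpr fun u v huv => ?_
  have hle : ∀ w ∈ Finset.univ, ((⊤ : SimpleGraph V).dist u w : ℝ) ≤ G.dist u w :=
    fun w _ => by exact_mod_cast hG.dist_top_le u w
  have heq := (Finset.sum_eq_sum_iff_of_le hle).mp
    ((Finset.sum_le_sum hle).antisymm ((h u).trans_eq (transmission_top u).symm))
      v (Finset.mem_univ v)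
  rw [← SimpleGraph.dist_eq_one_iff_adj, ← SimpleGraph.dist_top_of_ne huv.ne]
  exact_mod_cast heq.symm

theorem two_mul_sum_transmission_le {V : Type*} [Fintype V] [DecidableEq V]
    (G : SimpleGraph V) :
    2 * ∑ v, transmission G v ≤ specRad (distSignlessLap G) * Fintype.card V := by
  have h := (isHermitian_distSignlessLap G).dotProduct_mulVec_le_specRad 1
  simpa [dotProduct, mulVec, sum_distSignlessLap, ← Finset.mul_sum] using h

/-- For a connected graph on `n ≥ 2` vertices, the spectral radius of the distance signless
Laplacian is at least `2n - 2`, with equality if and only if the graph is complete. -/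
theorem specRad_distSignlessLap_ge_of_connected {n : ℕ} (hn : 2 ≤ n) (G : SimpleGraph (Fin n))
    (hG : G.Connected) :
    2 * (n : ℝ) - 2 ≤ specRad (distSignlessLap G) ∧
    (specRad (distSignlessLap G) = 2 * (n : ℝ) - 2 ↔ G = ⊤) := by
  have hn0 : (0 : ℝ) < n := by exact_mod_cast (show 0 < n by omega)
  have hn1 : (1 : ℝ) ≤ n := by exact_mod_cast (show 1 ≤ n by omega)
  have hray := two_mul_sum_transmission_le G
  have hge : ∀ v, (n : ℝ) - 1 ≤ transmission G v := by simpa using hG.transmission_ge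
  have hconst : ∑ _v : Fin n, ((n : ℝ) - 1) = n * (n - 1) := by simp [mul_sub]
  have hsum := hconst.symm.trans_le (Finset.sum_le_sum fun v _ => hge v)
  rw [Fintype.card_fin] at hray
  have hlow : 2 * (n : ℝ) - 2 ≤ specRad (distSignlessLap G) :=
    le_of_mul_le_mul_right (by linarith) hn0
  refine ⟨hlow, fun heq => ?_, ?_⟩
  · refine hG.eq_top_of_transmission_le fun v => ?_
    have hle : ∑ v, transmission G v ≤ ∑ _v : Fin n, ((n : ℝ) - 1) := by
      rw [heq] at hray
      linarith
    have := (Finset.sum_eq_sum_iff_of_le fun v _ => hge v).mp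
      ((Finset.sum_le_sum fun v _ => hge v).antisymm hle) v (Finset.mem_univ v)
    rw [Fintype.card_fin, this]
  · rintro rfl
    refine (specRad_le_of_forall_row _ (by linarith) fun u => ?_).antisymm hlow
    simp only [abs_of_nonneg (distSignlessLap_nonneg _ u _), sum_distSignlessLap,
      transmission_top, Fintype.card_fin]
    linarith
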